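/- arXiv:2408.15942 — 4 statements merged into one kernel-verified Lean document; each statement's English description precedes it below -/
import Mathlib

section
/- For natural numbers b, c with c − b ≥ 2, the number of distinct dyadic intervals that are maximal in Ico(b,c) is at most 2·log₂(c−b), where log₂ denotes the floor of the base-2 logarithm (Nat.log 2). -/
/-- A dyadic interval: a set of the form `Ico (2^p * q) (2^p * (q+1))`. -/
def IsDyadic (u : Set ℕ) : Prop :=
  ∃ p q : ℕ, u = Set.Ico (2 ^ p * q) (2 ^ p * (q + 1))

/-- A dyadic interval `u` is maximal in `Ico b c` if `u ⊆ Ico b c` and no strictly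
larger dyadic interval is contained in `Ico b c`. -/
def IsMaxDyadicIn (u : Set ℕ) (b c : ℕ) : Prop :=
  IsDyadic u ∧ u ⊆ Set.Ico b c ∧ ∀ v : Set ℕ, IsDyadic v → u ⊂ v → ¬ v ⊆ Set.Ico b c

/-- The dyadic interval of length `2 ^ p` with index `q`. -/
def dyadicBlock (p q : ℕ) : Set ℕ :=
  Set.Ico (2 ^ p * q) (2 ^ p * (q + 1))

/-- The dyadic interval `dyadicBlock p q` lies in `Ico b c`, is the right half of its parent,
and the parent sticks out on the left. -/
def IsLeftBlock (b c p q : ℕ) : Prop :=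
  Odd q ∧ b ≤ 2 ^ p * q ∧ 2 ^ p * (q + 1) ≤ c ∧ 2 ^ p * q < b + 2 ^ p

/-- The dyadic interval `dyadicBlock p q` lies in `Ico b c`, is the left half of its parent,
and the parent sticks out on the right. -/
def IsRightBlock (b c p q : ℕ) : Prop :=
  Even q ∧ b ≤ 2 ^ p * q ∧ 2 ^ p * (q + 1) ≤ c ∧ c < 2 ^ p * (q + 2)

theorem dyadicBlock_subset_Ico_iff {b c p q : ℕ} :
    dyadicBlock p q ⊆ Set.Ico b c ↔ b ≤ 2 ^ p * q ∧ 2 ^ p * (q + 1) ≤ c :=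
  Set.Ico_subset_Ico_iff (Nat.mul_lt_mul_of_pos_left (Nat.lt_succ_self q) (by positivity))

theorem dyadicBlock_ssubset_parent (p q : ℕ) :
    dyadicBlock p q ⊂ dyadicBlock (p + 1) (q / 2) := by
  have hp : 0 < 2 ^ p := by positivity
  have hle : 2 * (q / 2) ≤ q := by omega
  have hlt : q + 1 ≤ 2 * (q / 2 + 1) := by omega
  have h₁ := Nat.mul_le_mul_left (2 ^ p) hle
  have h₂ := Nat.mul_le_mul_left (2 ^ p) hlt
  have hsub : dyadicBlock p q ⊆ dyadicBlock (p + 1) (q / 2) := by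
    refine dyadicBlock_subset_Ico_iff.2 ⟨?_, ?_⟩ <;> rw [pow_succ, mul_assoc] <;> assumption
  refine hsub.ssubset_of_not_subset fun hsup => ?_
  obtain ⟨h₃, h₄⟩ := dyadicBlock_subset_Ico_iff.1 hsup
  rw [pow_succ] at h₃ h₄
  nlinarith

theorem IsMaxDyadicIn.exists_block {u : Set ℕ} {b c : ℕ} (hu : IsMaxDyadicIn u b c) :
    ∃ p q, u = dyadicBlock p q ∧ (IsLeftBlock b c p q ∨ IsRightBlock b c p q) := by
  obtain ⟨⟨p, q, rfl⟩, hsub, hmax⟩ := hu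
  refine ⟨p, q, rfl, ?_⟩
  obtain ⟨hb, hc⟩ := dyadicBlock_subset_Ico_iff.1 hsub
  have hpar := hmax _ ⟨p + 1, q / 2, rfl⟩ (dyadicBlock_ssubset_parent p q)
  have hpar' := mt dyadicBlock_subset_Ico_iff.2 hpar
  rcases Nat.even_or_odd q with hq | hq
  · refine Or.inr ⟨hq, hb, hc, ?_⟩
    obtain ⟨k, rfl⟩ := hq
    rw [show (k + k) / 2 = k by omega, pow_succ] at hpar'
    by_contra! hlt
    exact hpar' ⟨by linarith, by linarith⟩
  · refine Or.inl ⟨hq, hb, hc, ?_⟩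
    obtain ⟨k, rfl⟩ := hq
    rw [show (2 * k + 1) / 2 = k by omega, pow_succ] at hpar'
    by_contra! hlt
    exact hpar' ⟨by linarith, by linarith⟩

theorem IsLeftBlock.index_eq {b c p q : ℕ} (h : IsLeftBlock b c p q) :
    q = (b + 2 ^ p - 1) / 2 ^ p := by
  obtain ⟨-, hb, -, hlt⟩ := h
  have hp : 0 < 2 ^ p := by positivity
  symm
  rw [Nat.div_eq_iff hp]
  rw [mul_comm] at hb hlt
  omega

theorem IsRightBlock.index_eq {b c p q : ℕ} (h : IsRightBlock b c p q) :
    q = c / 2 ^ p - 1 := by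
  obtain ⟨-, -, hc, hlt⟩ := h
  have : c / 2 ^ p = q + 1 := Nat.div_eq_of_lt_le (by linarith) (by linarith)
  omega

theorem le_log_of_two_pow_mul {b c p q : ℕ} (hb : b ≤ 2 ^ p * q) (hc : 2 ^ p * (q + 1) ≤ c) :
    p ≤ Nat.log 2 (c - b) := by
  have hp : 0 < 2 ^ p := by positivity
  rw [mul_add] at hc
  exact Nat.le_log_of_pow_le one_lt_two (by omega)

/-- An interval of length less than `2 ^ (p + 1)` contains at most one dyadic interval of
length `2 ^ p`. -/
theorem index_eq_of_lt_two_pow {b c p q r : ℕ} (hlt : c < b + 2 ^ (p + 1))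
    (hbq : b ≤ 2 ^ p * q) (hcq : 2 ^ p * (q + 1) ≤ c)
    (hbr : b ≤ 2 ^ p * r) (hcr : 2 ^ p * (r + 1) ≤ c) : q = r := by
  rw [pow_succ] at hlt
  rcases lt_trichotomy q r with h | h | h
  · nlinarith [Nat.mul_le_mul_left (2 ^ p) (Nat.succ_le_of_lt h)]
  · exact h
  · nlinarith [Nat.mul_le_mul_left (2 ^ p) (Nat.succ_le_of_lt h)]

/-- If `Ico b c` contains a dyadic interval of length `2 ^ (p + 1)` together with a left and a
right block of length `2 ^ p`, then its length is at least `2 ^ (p + 2)`. -/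
theorem two_pow_le_of_left_right {b c p q r s : ℕ} (hb : b ≤ 2 ^ (p + 1) * q)
    (hc : 2 ^ (p + 1) * (q + 1) ≤ c) (hr : IsLeftBlock b c p r) (hs : IsRightBlock b c p s) :
    b + 2 ^ (p + 2) ≤ c := by
  obtain ⟨⟨k, rfl⟩, hbr, -, hr⟩ := hr
  obtain ⟨⟨l, rfl⟩, -, hcs, hs⟩ := hs
  have hkq : k < q := by
    have : 2 ^ p * (2 * k) < 2 ^ p * (2 * q) := by rw [pow_succ] at hb; linarith
    have := Nat.lt_of_mul_lt_mul_left this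
    omega
  have hql : q < l := by
    have : 2 ^ p * (2 * q + 2) < 2 ^ p * (l + l + 2) := by rw [pow_succ] at hc; linarith
    have := Nat.lt_of_mul_lt_mul_left this
    omega
  have := Nat.mul_le_mul_left (2 ^ p) (show 2 * k + 1 + 4 ≤ l + l + 1 by omega)
  rw [pow_add]
  linarith

/-- For `c - b ≥ 2`, there are at most `2 * log₂ (c - b)` maximal dyadic
subintervals of `Ico b c`. -/
theorem card_maxDyadic_le (b c : ℕ) (h : 2 ≤ c - b) :
    {u : Set ℕ | IsMaxDyadicIn u b c}.ncard ≤ 2 * Nat.log 2 (c - b) := by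
  classical
  obtain ⟨l, hl⟩ : ∃ l, Nat.log 2 (c - b) = l + 1 :=
    Nat.exists_eq_succ_of_ne_zero (Nat.log_pos one_lt_two h).ne'
  have hlen : c < b + 2 ^ (l + 2) := by
    have : c - b < 2 ^ (l + 2) := Nat.lt_pow_of_log_lt one_lt_two (by omega)
    generalize 2 ^ (l + 2) = N at this ⊢
    omega
  let left (p : ℕ) : Set ℕ := dyadicBlock p ((b + 2 ^ p - 1) / 2 ^ p)
  let right (p : ℕ) : Set ℕ := dyadicBlock p (c / 2 ^ p - 1)
  have hblock : ∀ u, IsMaxDyadicIn u b c → ∃ p q, u = dyadicBlock p q ∧ p ≤ l + 1 ∧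
      b ≤ 2 ^ p * q ∧ 2 ^ p * (q + 1) ≤ c ∧
      (IsLeftBlock b c p q ∧ u = left p ∨ IsRightBlock b c p q ∧ u = right p) := by
    intro u hu
    obtain ⟨p, q, rfl, hq⟩ := hu.exists_block
    obtain ⟨hb, hc⟩ := dyadicBlock_subset_Ico_iff.1 hu.2.1
    exact ⟨p, q, rfl, hl ▸ le_log_of_two_pow_mul hb hc, hb, hc,
      hq.imp (fun h => ⟨h, congrArg _ h.index_eq⟩) fun h => ⟨h, congrArg _ h.index_eq⟩⟩
  have hcover : ∀ (T : Finset (Set ℕ)) (m n : ℕ), T.card + m + n ≤ 2 * (l + 1) →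
      (∀ u, IsMaxDyadicIn u b c → u ∈ T ∨ (∃ p < m, left p = u) ∨ ∃ p < n, right p = u) →
      {u : Set ℕ | IsMaxDyadicIn u b c}.ncard ≤ 2 * (l + 1) := by
    intro T m n hcard hT
    have hsub : {u : Set ℕ | IsMaxDyadicIn u b c} ⊆
        ↑(T ∪ ((Finset.range m).image left ∪ (Finset.range n).image right)) := by
      intro u hu
      simpa using hT u hu
    have h₁ := Set.ncard_le_ncard hsub (Finset.finite_toSet _)
    rw [Set.ncard_coe_finset] at h₁
    have h₂ := Finset.card_union_le T ((Finset.range m).image left ∪ (Finset.range n).image right)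
    have h₃ := Finset.card_union_le ((Finset.range m).image left) ((Finset.range n).image right)
    have h₄ := Finset.card_image_le (s := Finset.range m) (f := left)
    have h₅ := Finset.card_image_le (s := Finset.range n) (f := right)
    rw [Finset.card_range] at h₄ h₅
    omega
  rw [hl]
  by_cases htop : ∃ q, b ≤ 2 ^ (l + 1) * q ∧ 2 ^ (l + 1) * (q + 1) ≤ c
  · obtain ⟨t, hbt, hct⟩ := htop
    have htop_eq : ∀ {q}, b ≤ 2 ^ (l + 1) * q → 2 ^ (l + 1) * (q + 1) ≤ c →
        dyadicBlock (l + 1) q = dyadicBlock (l + 1) t := fun hb hc =>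
      congrArg _ (index_eq_of_lt_two_pow hlen hb hc hbt hct)
    by_cases hleft : ∃ r, IsLeftBlock b c l r
    · obtain ⟨r, hr⟩ := hleft
      refine hcover {dyadicBlock (l + 1) t} (l + 1) l (by simp; omega) fun u hu => ?_
      obtain ⟨p, q, rfl, hp, hb, hc, hq⟩ := hblock u hu
      rcases hp.eq_or_lt with rfl | hp
      · exact Or.inl (Finset.mem_singleton.2 (htop_eq hb hc))
      rcases hq with ⟨-, hq⟩ | ⟨hs, hq⟩
      · exact Or.inr (Or.inl ⟨p, hp, hq.symm⟩)
      · refine Or.inr (Or.inr ⟨p, lt_of_le_of_ne (Nat.le_of_lt_succ hp) ?_, hq.symm⟩)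
        rintro rfl
        exact hlen.not_ge (two_pow_le_of_left_right hbt hct hr hs)
    · refine hcover {dyadicBlock (l + 1) t} l (l + 1) (by simp; omega) fun u hu => ?_
      obtain ⟨p, q, rfl, hp, hb, hc, hq⟩ := hblock u hu
      rcases hp.eq_or_lt with rfl | hp
      · exact Or.inl (Finset.mem_singleton.2 (htop_eq hb hc))
      rcases hq with ⟨hr, hq⟩ | ⟨-, hq⟩
      · refine Or.inr (Or.inl ⟨p, lt_of_le_of_ne (Nat.le_of_lt_succ hp) ?_, hq.symm⟩)
        rintro rfl
        exact hleft ⟨q, hr⟩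
      · exact Or.inr (Or.inr ⟨p, hp, hq.symm⟩)
  · refine hcover ∅ (l + 1) (l + 1) (by simp; omega) fun u hu => ?_
    obtain ⟨p, q, rfl, hp, hb, hc, hq⟩ := hblock u hu
    have hp : p < l + 1 := lt_of_le_of_ne hp (by rintro rfl; exact htop ⟨q, hb, hc⟩)
    exact Or.inr (hq.imp (fun h => ⟨p, hp, h.2.symm⟩) fun h => ⟨p, hp, h.2.symm⟩)
end

section
/- Let ℓ be a natural number and let b, c : Fin ℓ → ℕ with b i ≤ c i for all i. The box ∏_{i : Fin ℓ} Ico(b i, c i) ⊆ ℕ^ℓ is the disjoint union of the maximal-dyadic sub-boxes obtained by choosing, independently in each coordinate i, a dyadic interval maximal in Ico(b i, c i): these sub-boxes are pairwise disjoint and their union is the whole box. -/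
theorem mem_dyadic_iff (p q m : ℕ) :
    m ∈ Set.Ico (2 ^ p * q) (2 ^ p * (q + 1)) ↔ m / 2 ^ p = q := by
  have hp : 0 < 2 ^ p := by positivity
  rw [Set.mem_Ico, mul_comm, ← Nat.le_div_iff_mul_le hp, mul_comm, ← Nat.div_lt_iff_lt_mul hp]
  omega

theorem IsDyadic.subset_or_subset {u v : Set ℕ} (hu : IsDyadic u) (hv : IsDyadic v)
    {x : ℕ} (hxu : x ∈ u) (hxv : x ∈ v) : u ⊆ v ∨ v ⊆ u := by
  have subset_of_le : ∀ {p q p' q' : ℕ}, p ≤ p' →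
      x ∈ Set.Ico (2 ^ p * q) (2 ^ p * (q + 1)) →
      x ∈ Set.Ico (2 ^ p' * q') (2 ^ p' * (q' + 1)) →
      Set.Ico (2 ^ p * q) (2 ^ p * (q + 1)) ⊆ Set.Ico (2 ^ p' * q') (2 ^ p' * (q' + 1)) := by
    intro p q p' q' hp hx hx' y hy
    rw [mem_dyadic_iff] at hx hx' hy ⊢
    obtain ⟨k, rfl⟩ := Nat.exists_eq_add_of_le hp
    rw [pow_add, ← Nat.div_div_eq_div_mul] at hx' ⊢
    rw [hy, ← hx, hx']
  obtain ⟨p, q, rfl⟩ := hu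
  obtain ⟨p', q', rfl⟩ := hv
  rcases le_total p p' with hp | hp
  · exact Or.inl (subset_of_le hp hxu hxv)
  · exact Or.inr (subset_of_le hp hxv hxu)

theorem IsMaxDyadicIn.eq_of_mem {u v : Set ℕ} {b c : ℕ} (hu : IsMaxDyadicIn u b c)
    (hv : IsMaxDyadicIn v b c) {x : ℕ} (hxu : x ∈ u) (hxv : x ∈ v) : u = v := by
  by_contra hne
  rcases hu.1.subset_or_subset hv.1 hxu hxv with huv | hvu
  · exact hu.2.2 v hv.1 (huv.ssubset_of_ne hne) hv.2.1
  · exact hv.2.2 u hu.1 (hvu.ssubset_of_ne (Ne.symm hne)) hu.2.1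

theorem exists_isMaxDyadicIn_mem {b c x : ℕ} (hx : x ∈ Set.Ico b c) :
    ∃ u, IsMaxDyadicIn u b c ∧ x ∈ u := by
  have hfin : {u : Set ℕ | IsDyadic u ∧ u ⊆ Set.Ico b c ∧ x ∈ u}.Finite :=
    (Set.finite_Ico b c).finite_subsets.subset fun u hu => hu.2.1
  have hsingleton : Set.Ico (2 ^ 0 * x) (2 ^ 0 * (x + 1)) = {x} := by
    ext y
    rw [mem_dyadic_iff]
    simp
  obtain ⟨u, hu⟩ := hfin.exists_maximal
    ⟨{x}, ⟨0, x, hsingleton.symm⟩, Set.singleton_subset_iff.2 hx, rfl⟩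
  exact ⟨u, ⟨hu.prop.1, hu.prop.2.1, fun v hv huv hvs =>
    huv.2 (hu.le_of_ge ⟨hv, hvs, huv.1 hu.prop.2.2⟩ huv.1)⟩, hu.prop.2.2⟩

/-- The box `∏ i, Ico (b i) (c i)` is the disjoint union of its maximal-dyadic
sub-boxes: they are pairwise disjoint and their union is the whole box. -/
theorem box_eq_disjoint_union_maxDyadic_subboxes (ℓ : ℕ) (b c : Fin ℓ → ℕ)
    (h : ∀ i, b i ≤ c i) :
    (∀ u v : Fin ℓ → Set ℕ, (∀ i, IsMaxDyadicIn (u i) (b i) (c i)) →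
      (∀ i, IsMaxDyadicIn (v i) (b i) (c i)) → u ≠ v →
      Set.univ.pi u ∩ Set.univ.pi v = ∅) ∧
    (⋃ u ∈ {u : Fin ℓ → Set ℕ | ∀ i, IsMaxDyadicIn (u i) (b i) (c i)},
        Set.univ.pi u) = Set.univ.pi fun i => Set.Ico (b i) (c i) := by
  constructor
  · intro u v hu hv huv
    refine Set.eq_empty_iff_forall_notMem.2 fun x hx => huv (funext fun i => ?_)
    exact (hu i).eq_of_mem (hv i) (hx.1 i trivial) (hx.2 i trivial)
  · ext x
    simp only [Set.mem_iUnion, Set.mem_ofPred_eq, exists_prop]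
    constructor
    · rintro ⟨u, hu, hx⟩ i hi
      exact (hu i).2.1 (hx i hi)
    · intro hx
      choose u hu hxu using fun i => exists_isMaxDyadicIn_mem (hx i trivial)
      exact ⟨u, hu, fun i _ => hxu i⟩
end

section
/- Let ℓ be a natural number and let b, c : Fin ℓ → ℕ with c i − b i ≥ 2 for all i. Then the number of maximal-dyadic sub-boxes of the box ∏_{i : Fin ℓ} Ico(b i, c i), i.e. the number of families (u i)_{i : Fin ℓ} where each u i is a dyadic interval maximal in Ico(b i, c i), is at most ∏_{i : Fin ℓ} 2·log₂(c i − b i), where log₂ denotes the floor of the base-2 logarithm (Nat.log 2). In particular, if c i − b i ≤ n for all i, this number is at most (2·log₂ n)^ℓ. -/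
/-- The candidate for a maximal dyadic interval of length `2 ^ p` in `Ico b c`: for `true`, the right
half of the dyadic interval of length `2 ^ (p + 1)` that contains `b - 1`; for `false`, the left half
of the one that contains `c`. -/
def dyadicCandidate (b c : ℕ) : ℕ × Bool → Set ℕ
  | (p, true) => Set.Ico (2 ^ p * (2 * ((b - 1) / (2 * 2 ^ p)) + 1))
      (2 ^ p * (2 * ((b - 1) / (2 * 2 ^ p)) + 1 + 1))
  | (p, false) => Set.Ico (2 ^ p * (2 * (c / (2 * 2 ^ p)))) (2 ^ p * (2 * (c / (2 * 2 ^ p)) + 1))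

/-- The candidate encoded by `(p, t)` is contained in `Ico b c` while the dyadic interval of twice its
length around it is not, with `k` the index of the latter. -/
def IsStraddling (b c : ℕ) : ℕ × Bool → Prop
  | (p, true) => ∃ k, 2 ^ p * (2 * k) < b ∧ b ≤ 2 ^ p * (2 * k + 1) ∧ 2 ^ p * (2 * k + 2) ≤ c
  | (p, false) => ∃ k, b ≤ 2 ^ p * (2 * k) ∧ 2 ^ p * (2 * k + 1) ≤ c ∧ c < 2 ^ p * (2 * k + 2)

theorem Ico_dyadic_subset_iff {b c p q : ℕ} :
    Set.Ico (2 ^ p * q) (2 ^ p * (q + 1)) ⊆ Set.Ico b c ↔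
      b ≤ 2 ^ p * q ∧ 2 ^ p * (q + 1) ≤ c :=
  Set.Ico_subset_Ico_iff (Nat.mul_lt_mul_of_pos_left (Nat.lt_succ_self q) (by positivity))

theorem Ico_dyadic_ssubset_parent {p q k : ℕ} (hq : q = 2 * k ∨ q = 2 * k + 1) :
    Set.Ico (2 ^ p * q) (2 ^ p * (q + 1)) ⊂ Set.Ico (2 ^ (p + 1) * k) (2 ^ (p + 1) * (k + 1)) := by
  have hp : 0 < 2 ^ p := by positivity
  rw [ssubset_iff_subset_not_subset, Ico_dyadic_subset_iff, Ico_dyadic_subset_iff, pow_succ]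
  rcases hq with rfl | rfl <;> refine ⟨⟨?_, ?_⟩, fun h => ?_⟩ <;> nlinarith

theorem IsMaxDyadicIn.exists_isStraddling {u : Set ℕ} {b c : ℕ} (hu : IsMaxDyadicIn u b c) :
    ∃ x, IsStraddling b c x ∧ u = dyadicCandidate b c x := by
  obtain ⟨⟨p, q, rfl⟩, hsub, hmax⟩ := hu
  have hp : 0 < 2 ^ p := by positivity
  obtain ⟨hb, hc⟩ := Ico_dyadic_subset_iff.1 hsub
  obtain ⟨k, hk⟩ := Nat.even_or_odd' q
  have hparent := hmax _ ⟨p + 1, k, rfl⟩ (Ico_dyadic_ssubset_parent hk)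
  rw [Ico_dyadic_subset_iff, pow_succ] at hparent
  rcases hk with rfl | rfl
  · have hlt : c < 2 ^ p * (2 * k + 2) := by
      by_contra! hcon
      exact hparent ⟨by linarith, by linarith⟩
    have hk : c / (2 * 2 ^ p) = k :=
      Nat.div_eq_of_lt_le (by nlinarith) (by nlinarith)
    exact ⟨(p, false), ⟨k, hb, hc, hlt⟩, by simp only [dyadicCandidate, hk]⟩
  · have hlt : 2 ^ p * (2 * k) < b := by
      by_contra! hcon
      exact hparent ⟨by linarith, by linarith⟩
    have hk : (b - 1) / (2 * 2 ^ p) = k := by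
      refine Nat.div_eq_of_lt_le ?_ ?_
      · apply Nat.le_sub_one_of_lt; linarith
      · have : b - 1 < b := by omega
        nlinarith
    exact ⟨(p, true), ⟨k, hlt, hb, hc⟩, by simp only [dyadicCandidate, hk]⟩

theorem IsStraddling.two_pow_le {b c p : ℕ} {t : Bool} (h : IsStraddling b c (p, t)) :
    2 ^ p ≤ c - b := by
  apply Nat.le_sub_of_add_le
  cases t <;> obtain ⟨k, h₁, h₂, h₃⟩ := h <;> linarith

theorem IsStraddling.two_pow_succ_le {b c p : ℕ} (h : IsStraddling b c (p, true))
    (h' : IsStraddling b c (p, false)) : 2 ^ (p + 1) ≤ c - b := by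
  apply Nat.le_sub_of_add_le
  obtain ⟨k, h₁, h₂, h₃⟩ := h
  obtain ⟨m, h₁', h₂', h₃'⟩ := h'
  rw [pow_succ]
  rcases le_or_gt m k with hmk | hmk
  · have := Nat.mul_le_mul_left (2 ^ p) hmk
    linarith
  · have := Nat.mul_le_mul_left (2 ^ p) (Nat.succ_le_of_lt hmk)
    rw [Nat.succ_eq_add_one] at this
    linarith

theorem IsStraddling.two_pow_add_two_le {b c p : ℕ} {t : Bool} (h : IsStraddling b c (p, true))
    (h' : IsStraddling b c (p, false)) (ht : IsStraddling b c (p + 1, t)) :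
    2 ^ (p + 2) ≤ c - b := by
  apply Nat.le_sub_of_add_le
  obtain ⟨k, h₁, h₂, h₃⟩ := h
  obtain ⟨m, h₁', h₂', h₃'⟩ := h'
  obtain ⟨q, hqb, hqc⟩ : ∃ q, b ≤ 2 ^ p * (2 * q) ∧ 2 ^ p * (2 * q + 2) ≤ c := by
    cases t <;> obtain ⟨j, hj₁, hj₂, hj₃⟩ := ht <;> rw [pow_succ] at *
    · exact ⟨2 * j, by linarith, by linarith⟩
    · exact ⟨2 * j + 1, by linarith, by linarith⟩
  have hkq : 2 * k < 2 * q := Nat.lt_of_mul_lt_mul_left (h₁.trans_le hqb)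
  have hqm : 2 * q + 2 < 2 * m + 2 := Nat.lt_of_mul_lt_mul_left (hqc.trans_lt h₃')
  have := Nat.mul_le_mul_left (2 ^ p) (show k + 2 ≤ m by omega)
  rw [pow_add]
  linarith

/-- There are at most `2 * log₂ (c - b)` codes of straddling candidates: with `L = log₂ (c - b)`, there
are at most two of them at the levels `L - 1` and `L` together. -/
theorem exists_finset_isStraddling {b c : ℕ} (h : 2 ≤ c - b) :
    ∃ s : Finset (ℕ × Bool), s.card ≤ 2 * Nat.log 2 (c - b) ∧
      ∀ x, IsStraddling b c x → x ∈ s := by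
  obtain ⟨L, hL⟩ : ∃ L, Nat.log 2 (c - b) = L + 1 :=
    Nat.exists_eq_succ_of_ne_zero (Nat.log_pos one_lt_two h).ne'
  have hlt : c - b < 2 ^ (L + 2) := by
    simpa [hL] using Nat.lt_pow_succ_log_self one_lt_two (c - b)
  have hle {p : ℕ} {t : Bool} (hx : IsStraddling b c (p, t)) : p < L + 2 :=
    (Nat.pow_lt_pow_iff_right one_lt_two).1 (hx.two_pow_le.trans_lt hlt)
  rw [hL]
  by_cases htop : ∃ t, IsStraddling b c (L + 1, t)
  · obtain ⟨t, ht⟩ := htop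
    obtain ⟨r, hr⟩ : ∃ r, ¬ IsStraddling b c (L, r) := by
      by_contra! hall
      exact hlt.not_ge ((hall true).two_pow_add_two_le (hall false) ht)
    refine ⟨insert (L + 1, t) ((Finset.range (L + 1) ×ˢ Finset.univ).erase (L, r)), ?_, ?_⟩
    · refine (Finset.card_insert_le _ _).trans ?_
      rw [Finset.card_erase_of_mem (by simp), Finset.card_product]
      simp
      omega
    · rintro ⟨p, t'⟩ hx
      rw [Finset.mem_insert, Finset.mem_erase]
      rcases (Nat.lt_succ_iff_lt_or_eq.1 (hle hx)) with hp | rfl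
      · exact .inr ⟨fun heq => hr (heq ▸ hx), by simpa using hp⟩
      · left
        cases t <;> cases t' <;> try rfl
        · exact absurd (hx.two_pow_succ_le ht) hlt.not_ge
        · exact absurd (ht.two_pow_succ_le hx) hlt.not_ge
  · refine ⟨Finset.range (L + 1) ×ˢ Finset.univ, by simp [mul_comm], ?_⟩
    rintro ⟨p, t⟩ hx
    have hne : p ≠ L + 1 := by
      rintro rfl
      exact htop ⟨t, hx⟩
    have := hle hx
    simp
    omega

theorem exists_finset_isMaxDyadicIn {b c : ℕ} (h : 2 ≤ c - b) :
    ∃ s : Finset (Set ℕ), s.card ≤ 2 * Nat.log 2 (c - b) ∧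
      ∀ u, IsMaxDyadicIn u b c → u ∈ s := by
  classical
  obtain ⟨s, hcard, hs⟩ := exists_finset_isStraddling h
  refine ⟨s.image (dyadicCandidate b c), Finset.card_image_le.trans hcard, fun u hu => ?_⟩
  obtain ⟨x, hx, rfl⟩ := hu.exists_isStraddling
  exact Finset.mem_image_of_mem _ (hs x hx)

/-- The number of maximal-dyadic sub-boxes of the box `∏ i, Ico (b i) (c i)` is at
most `∏ i, 2 * log₂ (c i - b i)`; in particular, if `c i - b i ≤ n` for all `i`, it
is at most `(2 * log₂ n) ^ ℓ`. -/
theorem card_maxDyadic_subboxes_le (ℓ : ℕ) (b c : Fin ℓ → ℕ)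
    (h : ∀ i, 2 ≤ c i - b i) :
    {u : Fin ℓ → Set ℕ | ∀ i, IsMaxDyadicIn (u i) (b i) (c i)}.ncard ≤
      ∏ i : Fin ℓ, 2 * Nat.log 2 (c i - b i) ∧
    ∀ n : ℕ, (∀ i, c i - b i ≤ n) →
      {u : Fin ℓ → Set ℕ | ∀ i, IsMaxDyadicIn (u i) (b i) (c i)}.ncard ≤
        (2 * Nat.log 2 n) ^ ℓ := by
  have hprod : {u : Fin ℓ → Set ℕ | ∀ i, IsMaxDyadicIn (u i) (b i) (c i)}.ncard ≤
      ∏ i : Fin ℓ, 2 * Nat.log 2 (c i - b i) := by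
    choose s hcard hs using fun i => exists_finset_isMaxDyadicIn (h i)
    calc _ ≤ (Fintype.piFinset s : Set (Fin ℓ → Set ℕ)).ncard :=
          Set.ncard_le_ncard (fun u hu => by simpa using fun i => hs i _ (hu i))
            (Finset.finite_toSet _)
      _ = ∏ i, (s i).card := by rw [Set.ncard_coe_finset, Fintype.card_piFinset]
      _ ≤ _ := Finset.prod_le_prod' fun i _ => hcard i
  refine ⟨hprod, fun n hn => hprod.trans ?_⟩
  calc _ ≤ ∏ _i : Fin ℓ, 2 * Nat.log 2 n :=
        Finset.prod_le_prod' fun i _ => Nat.mul_le_mul_left 2 (Nat.log_mono_right (hn i))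
    _ = _ := by simp
end

section
/- Weighted counting by dyadic decomposition: let M be a commutative additive monoid, let θ : ℕ → M, and let b ≤ c be natural numbers. Then ∑_{x ∈ Ico(b,c)} θ(x) equals the sum, over all dyadic intervals u maximal in Ico(b,c), of ∑_{x ∈ u} θ(x). -/
theorem isDyadic_iff_exists_div_eq {u : Set ℕ} :
    IsDyadic u ↔ ∃ p q : ℕ, u = {m | m / 2 ^ p = q} := by
  have key (p q : ℕ) : Set.Ico (2 ^ p * q) (2 ^ p * (q + 1)) = {m | m / 2 ^ p = q} := by
    ext m
    have hp : 0 < 2 ^ p := by positivity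
    rw [Set.mem_Ico, Set.mem_ofPred_eq, Nat.div_eq_iff hp]
    rw [mul_add, mul_one, mul_comm]
    omega
  simp only [IsDyadic, key]

theorem isDyadic_singleton (x : ℕ) : IsDyadic {x} :=
  isDyadic_iff_exists_div_eq.2 ⟨0, x, by ext; simp⟩

theorem finite_setOf_isMaxDyadicIn (b c : ℕ) : {u : Set ℕ | IsMaxDyadicIn u b c}.Finite :=
  (Set.finite_Ico b c).finite_subsets.subset fun _ hu => hu.2.1

theorem pairwiseDisjoint_setOf_isMaxDyadicIn (b c : ℕ) :
    {u : Set ℕ | IsMaxDyadicIn u b c}.PairwiseDisjoint id := by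
  rintro u ⟨hu, hub, hmu⟩ v ⟨hv, hvb, hmv⟩ huv
  refine Set.disjoint_left.2 fun x hxu hxv => ?_
  rcases hu.subset_or_subset hv hxu hxv with hs | hs
  · exact hmu v hv (hs.ssubset_of_ne huv) hvb
  · exact hmv u hu (hs.ssubset_of_ne huv.symm) hub

theorem sUnion_setOf_isMaxDyadicIn (b c : ℕ) :
    ⋃₀ {u : Set ℕ | IsMaxDyadicIn u b c} = Set.Ico b c := by
  refine Set.Subset.antisymm (Set.sUnion_subset fun u hu => hu.2.1) fun x hx => ?_
  have hfin : {u : Set ℕ | IsDyadic u ∧ u ⊆ Set.Ico b c}.Finite :=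
    (Set.finite_Ico b c).finite_subsets.subset fun _ hu => hu.2
  obtain ⟨u, hxu, hu⟩ := hfin.exists_le_maximal
    (show {x} ∈ _ from ⟨isDyadic_singleton x, Set.singleton_subset_iff.2 hx⟩)
  exact ⟨u, ⟨hu.prop.1, hu.prop.2, fun v hv huv hvb => huv.2 (hu.2 ⟨hv, hvb⟩ huv.1)⟩,
    hxu (Set.mem_singleton x)⟩

/-- Weighted counting by dyadic decomposition: the sum of `θ` over `Ico b c` equals
the sum, over maximal dyadic subintervals `u` of `Ico b c`, of the sum of `θ` over `u`. -/
theorem sum_Ico_eq_sum_maxDyadic {M : Type*} [AddCommMonoid M] (θ : ℕ → M)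
    (b c : ℕ) (h : b ≤ c) :
    ∑ x ∈ Finset.Ico b c, θ x =
      ∑ᶠ u ∈ {u : Set ℕ | IsMaxDyadicIn u b c}, ∑ᶠ x ∈ u, θ x := by
  rw [← finsum_mem_sUnion (pairwiseDisjoint_setOf_isMaxDyadicIn b c)
    (finite_setOf_isMaxDyadicIn b c) fun u hu => (Set.finite_Ico b c).subset hu.2.1,
    sUnion_setOf_isMaxDyadicIn, ← Finset.coe_Ico, finsum_mem_coe_finset]
end
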